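/- arXiv:1806.08291 — 2 statements merged into one kernel-verified Lean document; each statement's English description precedes it below -/
import Mathlib

section
/- Let G be a spider with body v, and let I and J be independent sets of G with |I| = |J| such that I ↭ J, no token of I is (G,I)-rigid, and no token of J is (G,J)-rigid. Then the minimum length of a TS-sequence between I and J equals M*(G,I,J) + D*(G,I,J); that is, there exists a TS-sequence between I and J of length M*(G,I,J) + D*(G,I,J), and every TS-sequence between I and J has length at least M*(G,I,J) + D*(G,I,J). -/
/-!
Common definitions for formalizing "Shortest Reconfiguration Sequence for
Sliding Tokens on Spiders" (Hoang, Khorramian, Uehara).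
-/

namespace SlidingTokenPaper

variable {V : Type*} [Fintype V] [DecidableEq V]

/-- A finite vertex set is independent in `G`. -/
def IsIndep (G : SimpleGraph V) (I : Finset V) : Prop :=
  ∀ x ∈ I, ∀ y ∈ I, ¬ G.Adj x y

/-- One token slide: a token moves from `x` to `y` along an edge `xy`. -/
def Step (G : SimpleGraph V) (A B : Finset V) : Prop :=
  ∃ x y : V, G.Adj x y ∧ A \ B = {x} ∧ B \ A = {y}

/-- `S` is a TS-sequence between the independent sets `I` and `J` of `G`. -/
def IsTSSeq (G : SimpleGraph V) (I J : Finset V) (S : List (Finset V)) : Prop :=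
  S ≠ [] ∧ S.head? = some I ∧ S.getLast? = some J ∧
  (∀ A ∈ S, IsIndep G A ∧ A.card = I.card) ∧ List.Chain' (Step G) S

/-- The length of a TS-sequence: number of token slides. -/
def len (S : List (Finset V)) : ℕ := S.length - 1

/-- `I ↭ J`: there is a TS-sequence between `I` and `J`. -/
def Reconf (G : SimpleGraph V) (I J : Finset V) : Prop :=
  ∃ S, IsTSSeq G I J S

/-- `M*(G,I,J)`: the minimum over all bijections (target assignments)
`f : I → J` of `∑_{w ∈ I} dist_G(w, f(w))`. -/
noncomputable def Mstar (G : SimpleGraph V) (I J : Finset V) : ℕ :=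
  sInf { m : ℕ | ∃ e : {x // x ∈ I} ≃ {y // y ∈ J},
    m = ∑ x : {x // x ∈ I}, G.dist (x : V) ((e x : V)) }

/-- The number of occurrences of the move `x → y` in `S`. -/
def moveCount (S : List (Finset V)) (x y : V) : ℕ :=
  ((S.zip S.tail).filter fun p => p.1 \ p.2 = {x} ∧ p.2 \ p.1 = {y}).length

/-- `D_G(S, e)`: twice the minimum of the numbers of occurrences of the moves
`x → y` and `y → x` in `S`, where `e = xy`. -/
def detours (S : List (Finset V)) : Sym2 V → ℕ :=
  Sym2.lift ⟨fun x y => 2 * min (moveCount S x y) (moveCount S y x),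
    fun x y => by dsimp only; rw [min_comm]⟩

open scoped Classical in
/-- `D_G(S)`: the total number of detours `S` makes, summed over the edges. -/
noncomputable def totalDetours (G : SimpleGraph V) (S : List (Finset V)) : ℕ :=
  ∑ e ∈ Finset.univ.filter (· ∈ G.edgeSet), detours S e

/-- `D*(G,I,J)`: the minimum number of detours of a TS-sequence between `I` and `J`. -/
noncomputable def Dstar (G : SimpleGraph V) (I J : Finset V) : ℕ :=
  sInf { d : ℕ | ∃ S, IsTSSeq G I J S ∧ d = totalDetours G S }

/-- The token on `u ∈ I` is `(G, I)`-rigid: `u` belongs to every independent set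
reachable from `I`. -/
def RigidToken (G : SimpleGraph V) (I : Finset V) (u : V) : Prop :=
  ∀ I', Reconf G I I' → u ∈ I'

/-- `G` is a spider with body `v`: a tree with exactly one vertex of degree ≥ 3. -/
def IsSpider (G : SimpleGraph V) (v : V) : Prop :=
  G.IsTree ∧ 3 ≤ (G.neighborSet v).ncard ∧ ∀ w, 3 ≤ (G.neighborSet w).ncard → w = v

/-- For adjacent `x, y` in a tree `T`, `side T x y` is the vertex set of `T^x_y`,
the component of `T − xy` containing `y` (vertices strictly closer to `y` than to `x`). -/
def side (G : SimpleGraph V) (x y : V) : Set V :=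
  {z | G.dist z y < G.dist z x}

/-- `|I ∩ V(L)|` for the leg `L` of the spider with body `v` containing the
neighbor `w` of `v`. -/
noncomputable def legCard (G : SimpleGraph V) (I : Finset V) (v w : V) : ℕ :=
  ((I : Set V) ∩ side G v w).ncard

/-- `|I ∩ V(L)| − |J ∩ V(L)|` for the leg `L` of the spider indexed by the
neighbor `w` of the body `v`. -/
noncomputable def legDiff (G : SimpleGraph V) (I J : Finset V) (v w : V) : ℤ :=
  (legCard G I v w : ℤ) - (legCard G J v w : ℤ)

/-- The leg indexed by the neighbor `w₁` of `v` may serve as `L_1` in a labeling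
of the legs making `|I∩V(L_i)| − |J∩V(L_i)|` nondecreasing, i.e. it minimizes the
difference. -/
def IsFirstLeg (G : SimpleGraph V) (I J : Finset V) (v w₁ : V) : Prop :=
  G.Adj v w₁ ∧ ∀ w, G.Adj v w → legDiff G I J v w₁ ≤ legDiff G I J v w

/-- `I_L` for the leg `L` indexed by the neighbor `w` of the body `v`, where the
first leg (indexed by `w₁`) additionally receives `I ∩ {v}`. -/
noncomputable def ILeg (G : SimpleGraph V) (I : Finset V) (v w₁ w : V) : Set V :=
  ((I : Set V) ∩ side G v w) ∪ (if w = w₁ then (I : Set V) ∩ {v} else ∅)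

/-- `|I_L|` for the leg `L` indexed by the neighbor `w` of the body `v`. -/
noncomputable def ILegCard (G : SimpleGraph V) (I : Finset V) (v w₁ w : V) : ℕ :=
  (ILeg G I v w₁ w).ncard

/-- `S` makes a detour over the edge `ab`: both moves `a → b` and `b → a` occur in `S`. -/
def MakesDetour (S : List (Finset V)) (a b : V) : Prop :=
  0 < moveCount S a b ∧ 0 < moveCount S b a

open Classical in
/-- The indicator of the vertices joined to `y` once the edge `xy` is deleted. -/
noncomputable def farInd (G : SimpleGraph V) (x y z : V) : ℤ :=
  if (G.deleteEdges {s(x, y)}).Reachable y z then 1 else 0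

lemma farInd_right (G : SimpleGraph V) (x y : V) : farInd G x y y = 1 := by
  simp [farInd]

lemma farInd_left {G : SimpleGraph V} (hG : G.IsAcyclic) {x y : V} (h : G.Adj x y) :
    farInd G x y x = 0 := by
  have hb := SimpleGraph.isAcyclic_iff_forall_adj_isBridge.1 hG h
  rw [SimpleGraph.isBridge_iff] at hb
  simpa [farInd] using fun h' => hb h'.symm

lemma farInd_eq_of_reachable {G : SimpleGraph V} {x y a b : V}
    (h : (G.deleteEdges {s(x, y)}).Reachable a b) : farInd G x y a = farInd G x y b := by
  have : (G.deleteEdges {s(x, y)}).Reachable y a ↔ (G.deleteEdges {s(x, y)}).Reachable y b :=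
    ⟨fun h' => h'.trans h, fun h' => h'.trans h.symm⟩
  unfold farInd
  split_ifs <;> tauto

lemma farInd_eq_of_adj {G : SimpleGraph V} {x y a b : V} (h : G.Adj a b)
    (hne : s(a, b) ≠ s(x, y)) : farInd G x y a = farInd G x y b := by
  apply farInd_eq_of_reachable
  apply SimpleGraph.Adj.reachable
  rw [SimpleGraph.deleteEdges_adj]
  exact ⟨h, hne⟩

lemma farInd_eq_zero_or_one (G : SimpleGraph V) (x y z : V) :
    farInd G x y z = 0 ∨ farInd G x y z = 1 := by
  unfold farInd
  split_ifs <;> simp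

lemma farInd_parity {G : SimpleGraph V} (hG : G.IsAcyclic) {x y : V} (h : G.Adj x y) {a b : V}
    (p : G.Walk a b) : farInd G x y a = farInd G x y b ↔ Even (p.edges.count s(x, y)) := by
  induction p with
  | nil => simp
  | @cons a c b hac p ih =>
    rw [SimpleGraph.Walk.edges_cons, List.count_cons]
    by_cases he : s(a, c) = s(x, y)
    · simp only [he, beq_self_eq_true, if_true]
      rw [Nat.even_add_one, ← ih]
      have hx := farInd_left hG h
      have hy := farInd_right G x y
      rcases farInd_eq_zero_or_one G x y b with hb | hb <;>
      rcases Sym2.eq_iff.1 he with ⟨rfl, rfl⟩ | ⟨rfl, rfl⟩ <;> simp [hx, hy, hb]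
    · simp only [beq_iff_eq, he, if_false, add_zero]
      rw [← ih, farInd_eq_of_adj hac he]

lemma abs_farInd_sub_eq_count {G : SimpleGraph V} (hG : G.IsAcyclic) {x y : V} (h : G.Adj x y)
    {a b : V} (p : G.Walk a b) (hp : p.IsPath) :
    |farInd G x y b - farInd G x y a| = p.edges.count s(x, y) := by
  have h1 := farInd_parity hG h p
  have h2 : p.edges.count s(x, y) ≤ 1 := List.nodup_iff_count_le_one.1 hp.isTrail.edges_nodup _
  have h3 : p.edges.count s(x, y) = 0 ∨ p.edges.count s(x, y) = 1 := by omega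
  rcases h3 with h3 | h3 <;> rw [h3] at h1 ⊢ <;>
  rcases farInd_eq_zero_or_one G x y a with ha | ha <;>
  rcases farInd_eq_zero_or_one G x y b with hb | hb <;> rw [ha, hb] at h1 ⊢ <;> simp_all

lemma mem_edges_of_farInd_ne {G : SimpleGraph V} {x y a b : V} (p : G.Walk a b)
    (hne : farInd G x y a ≠ farInd G x y b) : s(x, y) ∈ p.edges := by
  by_contra hmem
  exact hne (farInd_eq_of_reachable ⟨p.toDeleteEdge _ hmem⟩)

lemma dist_eq_add_of_mem_support {G : SimpleGraph V} (hG : G.Connected) {a b u : V}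
    (p : G.Walk a b) (hp : p.length = G.dist a b) (hu : u ∈ p.support) :
    G.dist a b = G.dist a u + G.dist u b := by
  have h1 := congrArg SimpleGraph.Walk.length (p.take_spec hu)
  rw [SimpleGraph.Walk.length_append] at h1
  have h2 := SimpleGraph.dist_le (p.takeUntil u hu)
  have h3 := SimpleGraph.dist_le (p.dropUntil u hu)
  have h4 := hG.dist_triangle (u := a) (v := u) (w := b)
  omega

lemma dist_eq_of_farInd_lt {G : SimpleGraph V} (hG : G.IsTree) {x y a b : V} (h : G.Adj x y)
    (hab : farInd G x y a < farInd G x y b) :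
    G.dist a b = G.dist a x + 1 + G.dist y b := by
  have hb : farInd G x y x ≠ farInd G x y b := by
    rw [farInd_left hG.isAcyclic h]
    rcases farInd_eq_zero_or_one G x y a with ha | ha <;> omega
  obtain ⟨p, hp⟩ := hG.connected.exists_walk_length_eq_dist a b
  obtain ⟨q, hq⟩ := hG.connected.exists_walk_length_eq_dist x b
  have h1 := dist_eq_add_of_mem_support hG.connected p hp
    (p.fst_mem_support_of_mem_edges (mem_edges_of_farInd_ne p hab.ne))
  have h2 := dist_eq_add_of_mem_support hG.connected q hq
    (q.snd_mem_support_of_mem_edges (mem_edges_of_farInd_ne q hb))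
  rw [SimpleGraph.dist_eq_one_iff_adj.2 h] at h2
  omega

/-- The change of `farInd` from `a` to `b` across an edge, oriented by `Quot.out`. -/
noncomputable def edgeShift (G : SimpleGraph V) (e : Sym2 V) (a b : V) : ℤ :=
  farInd G e.out.1 e.out.2 b - farInd G e.out.1 e.out.2 a

lemma mk_out (e : Sym2 V) : s(e.out.1, e.out.2) = e := Quot.out_eq e

lemma adj_out {G : SimpleGraph V} {e : Sym2 V} (he : e ∈ G.edgeSet) : G.Adj e.out.1 e.out.2 := by
  rwa [← SimpleGraph.mem_edgeSet, mk_out]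

open scoped Classical in
lemma dist_eq_sum_abs_edgeShift {G : SimpleGraph V} (hG : G.IsTree) (a b : V) :
    (G.dist a b : ℤ) = ∑ e ∈ Finset.univ.filter (· ∈ G.edgeSet), |edgeShift G e a b| := by
  obtain ⟨p, hp⟩ := hG.connected.exists_walk_length_eq_dist a b
  have h1 : ∀ e ∈ Finset.univ.filter (· ∈ G.edgeSet),
      |edgeShift G e a b| = (p.edges.count e : ℤ) := by
    intro e he
    have := abs_farInd_sub_eq_count hG.isAcyclic (adj_out (Finset.mem_filter.1 he).2) p
      (p.isPath_of_length_eq_dist hp)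
    rwa [mk_out] at this
  rw [Finset.sum_congr rfl h1, ← hp, ← SimpleGraph.Walk.length_edges,
    ← List.sum_toFinset_count_eq_length]
  push_cast
  refine Finset.sum_subset (fun e he => ?_) fun e _ he => ?_
  · simpa using p.edges_subset_edgeSet (List.mem_toFinset.1 he)
  · simpa [List.count_eq_zero] using he

/-- The net number of tokens that must cross the edge `e` on the way from `I` to `J`. -/
noncomputable def netFlow (G : SimpleGraph V) (I J : Finset V) (e : Sym2 V) : ℤ :=
  ∑ z ∈ J, farInd G e.out.1 e.out.2 z - ∑ z ∈ I, farInd G e.out.1 e.out.2 z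

lemma sum_edgeShift (G : SimpleGraph V) {I J : Finset V} (e : Sym2 V)
    (f : {x // x ∈ I} ≃ {y // y ∈ J}) :
    ∑ w : {x // x ∈ I}, edgeShift G e w (f w) = netFlow G I J e := by
  simp only [edgeShift, netFlow, Finset.sum_sub_distrib]
  rw [f.sum_comp (fun z => farInd G e.out.1 e.out.2 (z : V)),
    Finset.sum_coe_sort J (fun z => farInd G e.out.1 e.out.2 z),
    Finset.sum_coe_sort I (fun z => farInd G e.out.1 e.out.2 z)]

open scoped Classical in
lemma sum_dist_eq {G : SimpleGraph V} (hG : G.IsTree) {I J : Finset V}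
    (f : {x // x ∈ I} ≃ {y // y ∈ J}) :
    ((∑ w : {x // x ∈ I}, G.dist (w : V) (f w) : ℕ) : ℤ) =
      ∑ e ∈ Finset.univ.filter (· ∈ G.edgeSet),
        ∑ w : {x // x ∈ I}, |edgeShift G e w (f w)| := by
  push_cast
  rw [Finset.sum_comm]
  exact Finset.sum_congr rfl fun w _ => dist_eq_sum_abs_edgeShift hG _ _

lemma sum_dist_swap_lt {G : SimpleGraph V} (hG : G.IsTree) {I J : Finset V}
    (f : {x // x ∈ I} ≃ {y // y ∈ J}) {e : Sym2 V} (he : e ∈ G.edgeSet) {w₁ w₂ : {x // x ∈ I}}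
    (h₁ : 0 < edgeShift G e w₁ (f w₁)) (h₂ : edgeShift G e w₂ (f w₂) < 0) :
    ∑ w : {x // x ∈ I}, G.dist (w : V) (((Equiv.swap w₁ w₂).trans f) w) <
      ∑ w : {x // x ∈ I}, G.dist (w : V) (f w) := by
  have hne : w₁ ≠ w₂ := by
    rintro rfl
    omega
  have key : ∑ w : {x // x ∈ I}, ((G.dist (w : V) (((Equiv.swap w₁ w₂).trans f) w) : ℤ) -
      G.dist (w : V) (f w)) = ((G.dist (w₁ : V) (f w₂) : ℤ) - G.dist (w₁ : V) (f w₁)) +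
        ((G.dist (w₂ : V) (f w₁) : ℤ) - G.dist (w₂ : V) (f w₂)) := by
    rw [Fintype.sum_eq_add w₁ w₂ hne]
    · simp
    · rintro w ⟨hw₁, hw₂⟩
      simp [Equiv.swap_apply_of_ne_of_ne hw₁ hw₂]
  have hadj := adj_out he
  have d₁ := dist_eq_of_farInd_lt hG hadj (sub_pos.1 h₁)
  have d₂ := dist_eq_of_farInd_lt hG hadj (sub_neg.1 h₂)
  have t₁ := hG.connected.dist_triangle (u := (w₁ : V)) (v := e.out.1) (w := f w₂)
  have t₂ := hG.connected.dist_triangle (u := (w₂ : V)) (v := e.out.2) (w := f w₁)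
  rw [G.dist_comm (u := (f w₂ : V)), G.dist_comm (u := (f w₂ : V)),
    G.dist_comm (v := (w₂ : V))] at d₂
  rw [Finset.sum_sub_distrib] at key
  zify
  omega

open scoped Classical in
lemma Mstar_eq_sum_abs_netFlow {G : SimpleGraph V} (hG : G.IsTree) {I J : Finset V}
    (hcard : I.card = J.card) :
    (Mstar G I J : ℤ) = ∑ e ∈ Finset.univ.filter (· ∈ G.edgeSet), |netFlow G I J e| := by
  have hne : { m : ℕ | ∃ e : {x // x ∈ I} ≃ {y // y ∈ J},
      m = ∑ x : {x // x ∈ I}, G.dist (x : V) ((e x : V)) }.Nonempty :=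
    ⟨_, Finset.equivOfCardEq hcard, rfl⟩
  obtain ⟨f, hf⟩ := Nat.sInf_mem hne
  have hmin : ∀ g : {x // x ∈ I} ≃ {y // y ∈ J},
      ∑ w : {x // x ∈ I}, G.dist (w : V) (f w) ≤ ∑ w : {x // x ∈ I}, G.dist (w : V) (g w) :=
    fun g => hf ▸ Nat.sInf_le ⟨g, rfl⟩
  unfold Mstar
  rw [hf, sum_dist_eq hG]
  refine Finset.sum_congr rfl fun e he => ?_
  rw [← sum_edgeShift G e f]
  by_cases hpos : ∃ w₁ : {x // x ∈ I}, 0 < edgeShift G e w₁ (f w₁)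
  · obtain ⟨w₁, h₁⟩ := hpos
    have hnn : ∀ w₂ : {x // x ∈ I}, 0 ≤ edgeShift G e w₂ (f w₂) := by
      intro w₂
      by_contra! h₂
      exact (hmin _).not_gt (sum_dist_swap_lt hG f (Finset.mem_filter.1 he).2 h₁ h₂)
    rw [abs_of_nonneg (Finset.sum_nonneg fun w _ => hnn w)]
    exact Finset.sum_congr rfl fun w _ => abs_of_nonneg (hnn w)
  · push Not at hpos
    rw [abs_of_nonpos (Finset.sum_nonpos fun w _ => hpos w), ← Finset.sum_neg_distrib]
    exact Finset.sum_congr rfl fun w _ => abs_of_nonpos (hpos w)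

lemma moveCount_cons_cons {A B : Finset V} {S : List (Finset V)} {a b : V}
    (hA : A \ B = {a}) (hB : B \ A = {b}) (x y : V) :
    moveCount (A :: B :: S) x y =
      (if a = x ∧ b = y then 1 else 0) + moveCount (B :: S) x y := by
  simp only [moveCount, List.tail_cons, List.zip_cons_cons, List.filter_cons, hA, hB,
    Finset.singleton_inj]
  split_ifs <;> simp_all [add_comm]

lemma moveCount_sub_moveCount {G : SimpleGraph V} (hG : G.IsAcyclic) {J : Finset V}
    {e : Sym2 V} (he : e ∈ G.edgeSet) (A : Finset V) (S : List (Finset V))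
    (hS : List.IsChain (Step G) (A :: S)) (hJ : (A :: S).getLast? = some J) :
    (moveCount (A :: S) e.out.1 e.out.2 : ℤ) - moveCount (A :: S) e.out.2 e.out.1 =
      netFlow G A J e := by
  induction S generalizing A with
  | nil =>
    obtain rfl : A = J := by simpa using hJ
    simp [moveCount, netFlow]
  | cons B S ih =>
    rw [List.isChain_cons_cons] at hS
    obtain ⟨⟨a, b, hab, hA, hB⟩, hS⟩ := hS
    have ih := ih B hS (by simpa using hJ)
    have hd := Finset.sum_sdiff_sub_sum_sdiff (s₁ := A) (s₂ := B)
      (f := farInd G e.out.1 e.out.2)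
    rw [hA, hB, Finset.sum_singleton, Finset.sum_singleton] at hd
    have hadj := adj_out he
    have hx := farInd_left hG hadj
    have hy := farInd_right G e.out.1 e.out.2
    have hstep : farInd G e.out.1 e.out.2 b - farInd G e.out.1 e.out.2 a =
        (if a = e.out.1 ∧ b = e.out.2 then 1 else 0) -
          (if a = e.out.2 ∧ b = e.out.1 then 1 else 0) := by
      by_cases hs : s(a, b) = s(e.out.1, e.out.2)
      · rcases Sym2.eq_iff.1 hs with ⟨rfl, rfl⟩ | ⟨rfl, rfl⟩
        · simp [hx, hy, hadj.ne]
        · simp [hx, hy, hadj.ne']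
      · rw [farInd_eq_of_adj hab hs]
        rw [Sym2.eq_iff, not_or] at hs
        simp [hs.1, hs.2]
    rw [moveCount_cons_cons hA hB, moveCount_cons_cons hA hB]
    unfold netFlow at ih ⊢
    push_cast
    linarith

open scoped Classical in
lemma sum_moveCount_eq_len {G : SimpleGraph V} (A : Finset V) (S : List (Finset V))
    (hS : List.IsChain (Step G) (A :: S)) :
    ∑ e ∈ Finset.univ.filter (· ∈ G.edgeSet),
      (moveCount (A :: S) e.out.1 e.out.2 + moveCount (A :: S) e.out.2 e.out.1) =
      len (A :: S) := by
  induction S generalizing A with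
  | nil => simp [moveCount, len]
  | cons B S ih =>
    rw [List.isChain_cons_cons] at hS
    obtain ⟨⟨a, b, hab, hA, hB⟩, hS⟩ := hS
    have hstep : ∀ e ∈ Finset.univ.filter (· ∈ G.edgeSet),
        moveCount (A :: B :: S) e.out.1 e.out.2 + moveCount (A :: B :: S) e.out.2 e.out.1 =
        (if s(a, b) = e then 1 else 0) +
        (moveCount (B :: S) e.out.1 e.out.2 + moveCount (B :: S) e.out.2 e.out.1) := by
      intro e he
      have hadj := adj_out (Finset.mem_filter.1 he).2
      rw [moveCount_cons_cons hA hB, moveCount_cons_cons hA hB]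
      have : (if s(a, b) = e then 1 else 0) =
          (if a = e.out.1 ∧ b = e.out.2 then 1 else 0) +
          (if a = e.out.2 ∧ b = e.out.1 then 1 else 0) := by
        have : s(a, b) = e ↔
            a = e.out.1 ∧ b = e.out.2 ∨ a = e.out.2 ∧ b = e.out.1 := by
          conv_lhs => rw [← mk_out e]
          exact Sym2.eq_iff
        have := hadj.ne
        split_ifs <;> simp_all
      omega
    rw [Finset.sum_congr rfl hstep, Finset.sum_add_distrib, ih B hS]
    simp [len, hab, add_comm]

lemma detours_eq (S : List (Finset V)) (e : Sym2 V) :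
    detours S e = 2 * min (moveCount S e.out.1 e.out.2) (moveCount S e.out.2 e.out.1) := by
  conv_lhs => rw [← mk_out e]
  rfl

/-- In a tree, the length of every TS-sequence splits into the transport cost and the detours. -/
lemma len_eq_Mstar_add_totalDetours {G : SimpleGraph V} (hG : G.IsTree) {I J : Finset V}
    (hcard : I.card = J.card) {S : List (Finset V)} (hS : IsTSSeq G I J S) :
    len S = Mstar G I J + totalDetours G S := by
  classical
  obtain ⟨hne, hhead, hlast, -, hchain⟩ := hS
  cases S with
  | nil => exact absurd rfl hne
  | cons A S =>
    obtain rfl : A = I := by simpa using hhead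
    rw [← sum_moveCount_eq_len A S hchain]
    zify
    rw [Mstar_eq_sum_abs_netFlow hG hcard, totalDetours]
    push_cast
    rw [← Finset.sum_add_distrib]
    refine Finset.sum_congr (by congr) fun e he => ?_
    rw [← moveCount_sub_moveCount hG.isAcyclic (Finset.mem_filter.1 he).2 A S hchain hlast,
      detours_eq]
    push_cast
    rcases le_total (moveCount (A :: S) e.out.1 e.out.2 : ℤ)
      (moveCount (A :: S) e.out.2 e.out.1) with h | h
    · rw [min_eq_left h, abs_of_nonpos (by linarith)]
      ring
    · rw [min_eq_right h, abs_of_nonneg (by linarith)]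
      ring

/-- For a spider `G` with body `v` and independent sets `I`, `J`
with `|I| = |J|`, `I ↭ J`, and no rigid tokens, the minimum length of a
TS-sequence between `I` and `J` is exactly `M*(G,I,J) + D*(G,I,J)`. -/
theorem spider_shortest_TS_sequence_length
    {V : Type*} [Fintype V] [DecidableEq V] (G : SimpleGraph V) (v : V)
    (hG : IsSpider G v) (I J : Finset V)
    (hI : IsIndep G I) (hJ : IsIndep G J) (hcard : I.card = J.card)
    (hreconf : Reconf G I J)
    (hIrigid : ∀ u ∈ I, ¬ RigidToken G I u)
    (hJrigid : ∀ u ∈ J, ¬ RigidToken G J u) :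
    (∃ S, IsTSSeq G I J S ∧ len S = Mstar G I J + Dstar G I J) ∧
    (∀ S, IsTSSeq G I J S → Mstar G I J + Dstar G I J ≤ len S) := by
  have hlen := fun S (hS : IsTSSeq G I J S) => len_eq_Mstar_add_totalDetours hG.1 hcard hS
  have hne : { d : ℕ | ∃ S, IsTSSeq G I J S ∧ d = totalDetours G S }.Nonempty := by
    obtain ⟨S, hS⟩ := hreconf
    exact ⟨totalDetours G S, S, hS, rfl⟩
  refine ⟨?_, fun S hS => ?_⟩
  · obtain ⟨S, hS, hd⟩ := Nat.sInf_mem hne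
    exact ⟨S, hS, by rw [hlen S hS, Dstar, hd]⟩
  · rw [hlen S hS]
    gcongr
    exact Nat.sInf_le ⟨S, hS, rfl⟩

end SlidingTokenPaper
end

section
/- Let T be a tree and let I and J be independent sets of T with |I| = |J|. For a bijection f : I → J, say that an edge e = xy of T is oppositely crossed under f if there exist distinct w, w′ ∈ I with w ∈ V(T^y_x), f(w) ∈ V(T^x_y), w′ ∈ V(T^x_y), and f(w′) ∈ V(T^y_x). Then for every bijection f : I → J there exists a bijection g : I → J such that no edge of T is oppositely crossed under g and ∑_{w∈I} dist_T(w, g(w)) ≤ ∑_{w∈I} dist_T(w, f(w)). In particular, M*(T,I,J) is attained by a bijection under which no edge is oppositely crossed. -/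
/-!
Common definitions for formalizing "Shortest Reconfiguration Sequence for
Sliding Tokens on Spiders" (Hoang, Khorramian, Uehara).
-/

namespace SlidingTokenPaper

variable {V : Type*} [Fintype V] [DecidableEq V]

/-- The edge `xy` of `T` is *oppositely crossed* under the target assignment `f`:
there are distinct `w, w' ∈ I` with `w ∈ V(T^y_x)`, `f(w) ∈ V(T^x_y)`,
`w' ∈ V(T^x_y)` and `f(w') ∈ V(T^y_x)`. -/
def OppCrossed {V : Type*} [Fintype V] [DecidableEq V] (T : SimpleGraph V)
    (I J : Finset V) (f : {x // x ∈ I} ≃ {y // y ∈ J}) (x y : V) : Prop :=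
  T.Adj x y ∧ ∃ w w' : {x // x ∈ I}, w ≠ w' ∧
    (w : V) ∈ side T y x ∧ ((f w : V)) ∈ side T x y ∧
    (w' : V) ∈ side T x y ∧ ((f w' : V)) ∈ side T y x

/-- An edge of a tree whose ends lie on different sides of the edge `xy` is `xy` itself. -/
lemma eq_of_adj_of_dist_lt {V : Type*} {T : SimpleGraph V} (hT : T.IsTree) {x y a b : V}
    (hxy : T.Adj x y) (hab : T.Adj a b) (ha : T.dist a x < T.dist a y)
    (hb : T.dist b y < T.dist b x) : a = x ∧ b = y := by
  have hax := hT.dist_eq_dist_add_one_of_adj a hxy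
  have hbx := hT.dist_eq_dist_add_one_of_adj b hxy
  have hx := hT.dist_eq_dist_add_one_of_adj x hab
  have hy := hT.dist_eq_dist_add_one_of_adj y hab
  simp only [T.dist_comm (u := x), T.dist_comm (u := y)] at hx hy
  obtain ⟨q, hq⟩ := hT.connected.exists_walk_length_eq_dist a x
  obtain ⟨p, hp⟩ := hT.connected.exists_walk_length_eq_dist b y
  have hq' : (q.concat hxy).IsPath :=
    SimpleGraph.Walk.isPath_of_length_eq_dist _ (by rw [SimpleGraph.Walk.length_concat]; omega)
  have hp' : (SimpleGraph.Walk.cons hab p).IsPath :=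
    SimpleGraph.Walk.isPath_of_length_eq_dist _ (by rw [SimpleGraph.Walk.length_cons]; omega)
  have hpq := congrArg Subtype.val
    ((hT.isAcyclic.subsingleton_path a y).elim ⟨_, hq'⟩ ⟨_, hp'⟩)
  cases q with
  | nil =>
    refine ⟨rfl, hT.connected.dist_eq_zero_iff.1 ?_⟩
    rw [SimpleGraph.dist_self] at *
    omega
  | cons h r =>
    simp only [SimpleGraph.Walk.concat_cons, SimpleGraph.Walk.cons.injEq] at hpq
    obtain ⟨rfl, -⟩ := hpq
    have := SimpleGraph.dist_le r
    rw [SimpleGraph.Walk.length_cons] at hq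
    omega

/-- A walk in a tree between the two sides of an edge `xy` passes through that edge. -/
lemma dist_add_dist_lt_length {V : Type*} {T : SimpleGraph V} (hT : T.IsTree) {x y : V}
    (hxy : T.Adj x y) {a b : V} (p : T.Walk a b) (ha : T.dist a x < T.dist a y)
    (hb : T.dist b y < T.dist b x) : T.dist a x + T.dist y b < p.length := by
  induction p with
  | nil => omega
  | @cons a c b h p ih =>
    rw [SimpleGraph.Walk.length_cons]
    rcases (hT.dist_ne_of_adj c hxy).lt_or_gt with hc | hc
    · have h1 := ih hc hb
      have h2 := hT.connected.dist_triangle (u := a) (v := c) (w := x)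
      rw [SimpleGraph.dist_eq_one_iff_adj.2 h] at h2
      omega
    · obtain ⟨rfl, rfl⟩ := eq_of_adj_of_dist_lt hT hxy h ha hc
      have := SimpleGraph.dist_le p
      rw [SimpleGraph.dist_self]
      omega

lemma dist_add_dist_lt_dist_of_mem_side {V : Type*} [Fintype V] [DecidableEq V]
    {T : SimpleGraph V} (hT : T.IsTree) {x y a b : V} (hxy : T.Adj x y)
    (ha : a ∈ side T y x) (hb : b ∈ side T x y) :
    T.dist a x + T.dist y b < T.dist a b := by
  obtain ⟨p, hp⟩ := hT.connected.exists_walk_length_eq_dist a b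
  exact hp ▸ dist_add_dist_lt_length hT hxy p ha hb

/-- Exchanging the targets of two tokens that cross an edge in opposite directions
strictly decreases the total distance. -/
lemma OppCrossed.exists_sum_dist_lt {V : Type*} [Fintype V] [DecidableEq V]
    {T : SimpleGraph V} (hT : T.IsTree) {I J : Finset V}
    {f : {x // x ∈ I} ≃ {y // y ∈ J}} {x y : V} (h : OppCrossed T I J f x y) :
    ∃ g : {x // x ∈ I} ≃ {y // y ∈ J},
      ∑ w : {x // x ∈ I}, T.dist (w : V) (g w : V) <
        ∑ w : {x // x ∈ I}, T.dist (w : V) (f w : V) := by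
  obtain ⟨hxy, w, w', hne, hw, hfw, hw', hfw'⟩ := h
  refine ⟨(Equiv.swap w w').trans f, ?_⟩
  have hw'_mem : w' ∈ Finset.univ.erase w := by simp [hne.symm]
  simp only [← Finset.add_sum_erase _ _ (Finset.mem_univ w),
    ← Finset.add_sum_erase _ _ hw'_mem, Equiv.trans_apply, Equiv.swap_apply_left,
    Equiv.swap_apply_right]
  have hrest : ∑ v ∈ (Finset.univ.erase w).erase w',
        T.dist (v : V) (f (Equiv.swap w w' v) : V) =
      ∑ v ∈ (Finset.univ.erase w).erase w', T.dist (v : V) (f v : V) := by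
    refine Finset.sum_congr rfl fun v hv => ?_
    simp only [Finset.mem_erase] at hv
    rw [Equiv.swap_apply_of_ne_of_ne hv.2.1 hv.1]
  have h1 := dist_add_dist_lt_dist_of_mem_side hT hxy hw hfw
  have h2 := dist_add_dist_lt_dist_of_mem_side hT hxy.symm hw' hfw'
  have h3 := hT.connected.dist_triangle (u := (w : V)) (v := x) (w := (f w' : V))
  have h4 := hT.connected.dist_triangle (u := (w' : V)) (v := y) (w := (f w : V))
  omega

/-- Every target assignment can be improved to one with no
oppositely crossed edge without increasing the total distance; in particular
`M*(T,I,J)` is attained by an assignment with no oppositely crossed edge. -/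
theorem exists_uncrossed_target_assignment
    {V : Type*} [Fintype V] [DecidableEq V] (T : SimpleGraph V) (hT : T.IsTree)
    (I J : Finset V) (hI : IsIndep T I) (hJ : IsIndep T J)
    (hcard : I.card = J.card) :
    (∀ f : {x // x ∈ I} ≃ {y // y ∈ J},
      ∃ g : {x // x ∈ I} ≃ {y // y ∈ J},
        (∀ x y : V, ¬ OppCrossed T I J g x y) ∧
        ∑ w : {x // x ∈ I}, T.dist (w : V) ((g w : V)) ≤
          ∑ w : {x // x ∈ I}, T.dist (w : V) ((f w : V))) ∧
    (∃ g : {x // x ∈ I} ≃ {y // y ∈ J},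
      (∀ x y : V, ¬ OppCrossed T I J g x y) ∧
      ∑ w : {x // x ∈ I}, T.dist (w : V) ((g w : V)) = Mstar T I J) := by
  have hne : Nonempty ({x // x ∈ I} ≃ {y // y ∈ J}) := ⟨Finset.equivOfCardEq hcard⟩
  obtain ⟨g, hg⟩ := Finite.exists_min fun f : {x // x ∈ I} ≃ {y // y ∈ J} =>
    ∑ w : {x // x ∈ I}, T.dist (w : V) (f w : V)
  have huncrossed : ∀ x y : V, ¬ OppCrossed T I J g x y := fun x y h =>
    have ⟨g', hg'⟩ := h.exists_sum_dist_lt hT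
    (hg g').not_gt hg'
  refine ⟨fun f => ⟨g, huncrossed, hg f⟩, g, huncrossed, ?_⟩
  refine le_antisymm (le_csInf ⟨_, g, rfl⟩ ?_) (Nat.sInf_le ⟨g, rfl⟩)
  rintro m ⟨f, rfl⟩
  exact hg f

end SlidingTokenPaper
end
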